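/- For every n ≥ 1 there exist constants ν₀ > 0, r_λ > 0 and c > 0, depending only on n, with the following property. Let λ = (λ_a)_{a ≠ 0ⁿ} ∈ ℝ^{4ⁿ−1} satisfy |λ_a| ≤ 1 for all a, let ν ≥ ν₀, let μ ∈ ℝ^{4ⁿ−1} with ‖μ − λ‖ ≤ r_λ, and let Ê ∈ ℝ^{n·6ⁿ} with ‖Ê − E(λ,ν)‖ ≤ cν. Then the function μ' ↦ L(Ê, μ', ν) is twice continuously differentiable in a neighborhood of μ, and its Hessian at μ satisfies ⟨v, (∂²L/∂μ²)(Ê, μ, ν) v⟩ ≥ 2^{n−1} ‖v‖² for all v ∈ ℝ^{4ⁿ−1}; i.e., every eigenvalue of the Hessian matrix is at least 2^{n−1}. -/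

import Mathlib

open Matrix

noncomputable def specNorm {n : Type*} [Fintype n] [DecidableEq n] (A : Matrix n n ℂ) : ℝ :=
  ‖Matrix.toEuclideanCLM (𝕜 := ℂ) A‖

noncomputable def kthSmallest {ι : Type*} [Fintype ι] (f : ι → ℝ) (k : ℕ) : ℝ :=
  ((Finset.univ.val.map f).sort (· ≤ ·)).getD k 0

noncomputable def euclNorm {ι : Type*} [Fintype ι] (v : ι → ℂ) : ℝ :=
  ‖((WithLp.equiv 2 (ι → ℂ)).symm v : EuclideanSpace ℂ ι)‖
/-- The Pauli matrices. -/
noncomputable def pauli : Fin 4 → Matrix (Fin 2) (Fin 2) ℂ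
  | 0 => 1
  | 1 => !![0, 1; 1, 0]
  | 2 => !![0, -Complex.I; Complex.I, 0]
  | 3 => !![1, 0; 0, -1]

/-- The Pauli string σ^a on n qubits. -/
noncomputable def pauliString {n : ℕ} (a : Fin n → Fin 4) :
    Matrix (Fin n → Fin 2) (Fin n → Fin 2) ℂ :=
  fun x y => ∏ j, pauli (a j) (x j) (y j)

/-- Index set for nontrivial Pauli strings. -/
abbrev PIdx (n : ℕ) := {a : Fin n → Fin 4 // a ≠ fun _ => 0}

/-- The unknown Hamiltonian H(μ). -/
noncomputable def Hmat {n : ℕ} (lam : PIdx n → ℝ) :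
    Matrix (Fin n → Fin 2) (Fin n → Fin 2) ℂ :=
  ∑ a : PIdx n, (lam a : ℂ) • pauliString a.val

/-- σ^(β+1) acting on the j-th qubit. -/
noncomputable def pauliAt {n : ℕ} (j : Fin n) (b : Fin 3) :
    Matrix (Fin n → Fin 2) (Fin n → Fin 2) ℂ :=
  pauliString (fun i => if i = j then b.succ else 0)

/-- The control Hamiltonian. -/
noncomputable def Hctrl {n : ℕ} (k : Fin n) (s : Fin n → Fin 2) (β : Fin n → Fin 3) :
    Matrix (Fin n → Fin 2) (Fin n → Fin 2) ℂ :=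
  (∑ j ∈ Finset.univ.erase k, ((-1 : ℂ) ^ (s j : ℕ)) • pauliAt j (β j))
    + (((-1 : ℂ) ^ (s k : ℕ)) / 2) • pauliAt k (β k)

/-- The total Hamiltonian. -/
noncomputable def Htot {n : ℕ} (lam : PIdx n → ℝ) (ν : ℝ) (k : Fin n) (s : Fin n → Fin 2)
    (β : Fin n → Fin 3) : Matrix (Fin n → Fin 2) (Fin n → Fin 2) ℂ :=
  Hmat lam - (ν : ℂ) • Hctrl k s β

open Classical in
/-- The gap between the two smallest eigenvalues of H_tot. -/
noncomputable def Egap {n : ℕ} (lam : PIdx n → ℝ) (ν : ℝ) (k : Fin n) (s : Fin n → Fin 2)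
    (β : Fin n → Fin 3) : ℝ :=
  if h : (Htot lam ν k s β).IsHermitian then
    kthSmallest h.eigenvalues 1 - kthSmallest h.eigenvalues 0
  else 0

abbrev EIdx (n : ℕ) := Fin n × (Fin n → Fin 2) × (Fin n → Fin 3)

/-- The vector of all gaps, in ℝ^{n·6^n}. -/
noncomputable def EvecE {n : ℕ} (μ : EuclideanSpace ℝ (PIdx n)) (ν : ℝ) :
    EuclideanSpace ℝ (EIdx n) :=
  (WithLp.equiv 2 _).symm (fun p => Egap ((WithLp.equiv 2 _) μ) ν p.1 p.2.1 p.2.2)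

/-- The least-squares loss. -/
noncomputable def Lloss {n : ℕ} (Ehat : EuclideanSpace ℝ (EIdx n))
    (μ : EuclideanSpace ℝ (PIdx n)) (ν : ℝ) : ℝ :=
  (1 / 2) * ‖Ehat - EvecE μ ν‖ ^ 2

open Filter Topology

section SpectralGap

variable {ι : Type*} [Fintype ι]

theorem kthSmallest_zero_one [DecidableEq ι] (f : ι → ℝ) {i j : ι} (hij : i ≠ j)
    (hle : f i ≤ f j) (h : ∀ k, k ≠ i → k ≠ j → f j ≤ f k) :
    kthSmallest f 0 = f i ∧ kthSmallest f 1 = f j := by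
  have hM : (Finset.univ : Finset ι).val.map f
      = f i ::ₘ f j ::ₘ (((Finset.univ : Finset ι).erase i).erase j).val.map f := by
    rw [← Multiset.map_cons, ← Multiset.map_cons, Finset.erase_val, Multiset.cons_erase,
      Finset.erase_val, Multiset.cons_erase]
    · exact Finset.mem_univ_val i
    · exact Finset.mem_erase.2 ⟨hij.symm, Finset.mem_univ j⟩
  have hrest : ∀ b ∈ (((Finset.univ : Finset ι).erase i).erase j).val.map f, f j ≤ b := by
    intro b hb
    obtain ⟨k, hk, rfl⟩ := Multiset.mem_map.1 hb
    have hk' : k ∈ ((Finset.univ : Finset ι).erase i).erase j := hk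
    simp only [Finset.mem_erase] at hk'
    exact h k hk'.2.1 hk'.1
  have hsort : ((Finset.univ : Finset ι).val.map f).sort (· ≤ ·)
      = f i :: f j :: ((((Finset.univ : Finset ι).erase i).erase j).val.map f).sort (· ≤ ·) := by
    rw [hM, Multiset.sort_cons, Multiset.sort_cons]
    · exact hrest
    · intro b hb
      rcases Multiset.mem_cons.1 hb with rfl | hb
      · exact hle
      · exact hle.trans (hrest b hb)
  simp [kthSmallest, hsort]

open Classical in
/-- The gap between the two smallest eigenvalues of a Hermitian matrix. -/
noncomputable def specGap (A : Matrix ι ι ℂ) : ℝ :=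
  if h : A.IsHermitian then kthSmallest h.eigenvalues 1 - kthSmallest h.eigenvalues 0 else 0

theorem specGap_unitary_conj [DecidableEq ι] {U : Matrix ι ι ℂ} (hU : U * Uᴴ = 1)
    {A : Matrix ι ι ℂ} (hA : A.IsHermitian) : specGap (Uᴴ * A * U) = specGap A := by
  have hB : (Uᴴ * A * U).IsHermitian := isHermitian_conjTranspose_mul_mul U hA
  have h : (Uᴴ * A * U).charpoly = A.charpoly := by
    rw [charpoly_mul_comm, ← mul_assoc, hU, one_mul]
  have he : hB.eigenvalues = hA.eigenvalues := by
    classical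
    convert (hB.eigenvalues_eq_eigenvalues_iff hA).2 (by convert h)
  simp only [specGap]
  rw [dif_pos hA, dif_pos hB]
  convert congrArg (fun f => kthSmallest f 1 - kthSmallest f 0) he

theorem Matrix.IsHermitian.exists_eigenvalues_eq [DecidableEq ι] {A : Matrix ι ι ℂ}
    (hA : A.IsHermitian) {v : ι → ℂ} (hv : v ≠ 0) {t : ℂ} (h : A *ᵥ v = t • v) :
    ∃ i, (hA.eigenvalues i : ℂ) = t := by
  have hmem : t ∈ spectrum ℂ A := by
    rw [← Matrix.spectrum_toLin']
    apply Module.End.HasEigenvalue.mem_spectrum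
    exact Module.End.hasEigenvalue_of_hasEigenvector
      ⟨Module.End.mem_eigenspace_iff.2 (by simpa using h), hv⟩
  rw [hA.spectrum_eq_image_range] at hmem
  obtain ⟨_, ⟨i, rfl⟩, hi⟩ := hmem
  exact ⟨i, hi⟩

theorem Matrix.IsHermitian.exists_le_eigenvalues [DecidableEq ι] {A : Matrix ι ι ℂ}
    (hA : A.IsHermitian) {i₀ i₁ : ι} {θ : ℝ}
    (hform : ∀ w : ι → ℂ, w i₀ = 0 → w i₁ = 0 →
      θ * ∑ i, ‖w i‖ ^ 2 ≤ (star w ⬝ᵥ A *ᵥ w).re)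
    {σ : Fin 3 → ι} (hσ : Function.Injective σ) : ∃ k, θ ≤ hA.eigenvalues (σ k) := by
  by_contra! hlt
  let e : Fin 3 → EuclideanSpace ℂ ι := fun k => hA.eigenvectorBasis (σ k)
  have he : Orthonormal ℂ e := hA.eigenvectorBasis.orthonormal.comp σ hσ
  let L : (Fin 3 → ℂ) →ₗ[ℂ] (Fin 2 → ℂ) :=
    Matrix.toLin' (Matrix.of ![fun k => e k i₀, fun k => e k i₁])
  have hker : LinearMap.ker L ≠ ⊥ := LinearMap.ker_ne_bot_of_finrank_lt (by simp)
  obtain ⟨c, hc, hc0⟩ := Submodule.exists_mem_ne_zero_of_ne_bot hker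
  rw [LinearMap.mem_ker] at hc
  let w : EuclideanSpace ℂ ι := ∑ k, c k • e k
  have hw : ∀ i, w i = ∑ k, e k i * c k := by
    intro i
    simp [w, mul_comm]
  have h0 := hform w (by rw [hw]; simpa [L, mulVec, dotProduct] using congrFun hc 0)
    (by rw [hw]; simpa [L, mulVec, dotProduct] using congrFun hc 1)
  have hAw : A *ᵥ w = (∑ k, (c k * hA.eigenvalues (σ k)) • e k : EuclideanSpace ℂ ι) := by
    have hw' : (w : ι → ℂ) = ∑ k, c k • (e k : ι → ℂ) := by
      ext i; simp [w]
    rw [hw', Matrix.mulVec_sum]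
    ext i
    have := fun k => congrFun (hA.mulVec_eigenvectorBasis (σ k)) i
    simp only [Pi.smul_apply, Complex.real_smul] at this
    simp [Matrix.mulVec_smul, e, this, mul_assoc]
  have hinner : star (w : ι → ℂ) ⬝ᵥ A *ᵥ w
      = ∑ k, (hA.eigenvalues (σ k) * ‖c k‖ ^ 2 : ℝ) := by
    have h1 : star (w : ι → ℂ) ⬝ᵥ A *ᵥ w
        = inner ℂ w (∑ k, (c k * hA.eigenvalues (σ k)) • e k) := by
      rw [hAw, dotProduct_comm]; rfl
    rw [h1, he.inner_sum]
    push_cast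
    refine Finset.sum_congr rfl fun k _ => ?_
    rw [← mul_assoc, mul_comm _ (c k), Complex.mul_conj, Complex.normSq_eq_norm_sq]
    push_cast; ring
  have hnorm : ∑ i, ‖w i‖ ^ 2 = ∑ k, ‖c k‖ ^ 2 := by
    rw [← EuclideanSpace.norm_sq_eq, ← inner_self_eq_norm_sq (𝕜 := ℂ), he.inner_sum]
    simp [Complex.conj_mul', ← Complex.ofReal_pow]
  rw [hinner, hnorm, Complex.ofReal_re, Finset.mul_sum] at h0
  obtain ⟨k, hk⟩ := Function.ne_iff.1 hc0
  refine absurd h0 (not_le.2 (Finset.sum_lt_sum (fun k _ => ?_) ⟨k, Finset.mem_univ k, ?_⟩))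
  · exact mul_le_mul_of_nonneg_right (hlt k).le (by positivity)
  · exact mul_lt_mul_of_pos_right (hlt k) (by have := norm_pos_iff.2 hk; positivity)

theorem specGap_eq_sub [DecidableEq ι] {A : Matrix ι ι ℂ} (hA : A.IsHermitian) {i₀ i₁ : ι}
    {θ : ℝ} (hform : ∀ w : ι → ℂ, w i₀ = 0 → w i₁ = 0 →
      θ * ∑ i, ‖w i‖ ^ 2 ≤ (star w ⬝ᵥ A *ᵥ w).re)
    {t₀ t₁ : ℂ} {v₀ v₁ : ι → ℂ} (hv₀ : v₀ ≠ 0) (hv₁ : v₁ ≠ 0) (h₀ : A *ᵥ v₀ = t₀ • v₀)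
    (h₁ : A *ᵥ v₁ = t₁ • v₁) (hlt : t₀.re < t₁.re) (hθ : t₁.re < θ) :
    specGap A = t₁.re - t₀.re := by
  obtain ⟨i, hi⟩ := hA.exists_eigenvalues_eq hv₀ h₀
  obtain ⟨j, hj⟩ := hA.exists_eigenvalues_eq hv₁ h₁
  rw [← hi, ← hj, Complex.ofReal_re, Complex.ofReal_re] at hlt
  rw [← hj, Complex.ofReal_re] at hθ
  have hij : i ≠ j := by rintro rfl; exact lt_irrefl _ hlt
  have hrest : ∀ k, k ≠ i → k ≠ j → hA.eigenvalues j ≤ hA.eigenvalues k := by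
    intro k hki hkj
    obtain ⟨l, hl⟩ := hA.exists_le_eigenvalues hform (σ := ![i, j, k]) (by
      intro a b hab
      fin_cases a <;> fin_cases b <;> simp_all)
    fin_cases l
    · exact absurd hl (not_le.2 (hlt.trans hθ))
    · exact absurd hl (not_le.2 hθ)
    · exact hθ.le.trans hl
  obtain ⟨hk₀, hk₁⟩ := kthSmallest_zero_one _ hij hlt.le hrest
  have : specGap A = kthSmallest hA.eigenvalues 1 - kthSmallest hA.eigenvalues 0 := by
    simp only [specGap]
    rw [dif_pos hA]
    congr!
  rw [this, hk₀, hk₁, ← hi, ← hj, Complex.ofReal_re, Complex.ofReal_re]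

end SpectralGap

section SmoothEigenvalue

variable {ι : Type*} [Fintype ι] [DecidableEq ι]
  {E : Type*} [NormedAddCommGroup E] [NormedSpace ℝ E] [FiniteDimensional ℝ E]

/-- The eigenvector candidate with `i₀`-th component `1`; the `i₀`-th component of `y` is left
free to encode the eigenvalue. -/
def normalizedVec (i₀ : ι) (y : ι → ℂ) : ι → ℂ := fun j => if j = i₀ then 1 else y j

/-- The eigenvalue equation for `diag d + W x`, with eigenvalue `y i₀` and eigenvector
`normalizedVec i₀ y`. -/
noncomputable def eigenEquation (W : E →ₗ[ℝ] Matrix ι ι ℂ) (d : ι → ℝ) (i₀ : ι)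
    (p : E × (ι → ℂ)) : ι → ℂ :=
  fun i => (d i : ℂ) * normalizedVec i₀ p.2 i
    + ∑ j, (LinearMap.toContinuousLinearMap (Matrix.entryLinearMap ℝ ℂ i j ∘ₗ W)) p.1
      * normalizedVec i₀ p.2 j
    - p.2 i₀ * normalizedVec i₀ p.2 i

theorem eigenEquation_eq (W : E →ₗ[ℝ] Matrix ι ι ℂ) (d : ι → ℝ) (i₀ : ι) (x : E) (y : ι → ℂ) :
    eigenEquation W d i₀ (x, y)
      = (diagonal (fun i => (d i : ℂ)) + W x) *ᵥ normalizedVec i₀ y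
        - y i₀ • normalizedVec i₀ y := by
  ext i
  rw [Matrix.add_mulVec, Pi.sub_apply, Pi.add_apply, Matrix.mulVec_diagonal]
  simp [eigenEquation, Matrix.mulVec, dotProduct]

omit [Fintype ι] in
theorem normalizedVec_single (i₀ j : ι) (c : ℂ) :
    normalizedVec i₀ (Pi.single i₀ c) j = if j = i₀ then 1 else 0 := by
  unfold normalizedVec
  split_ifs with h <;> simp [h]

omit [FiniteDimensional ℝ E] in
theorem contDiff_normalizedVec (i₀ j : ι) :
    ContDiff ℝ 2 (fun p : E × (ι → ℂ) => normalizedVec i₀ p.2 j) := by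
  unfold normalizedVec
  split_ifs <;> fun_prop

theorem contDiff_eigenEquation (W : E →ₗ[ℝ] Matrix ι ι ℂ) (d : ι → ℝ) (i₀ : ι) :
    ContDiff ℝ 2 (eigenEquation W d i₀) := by
  refine contDiff_pi.2 fun i => ?_
  have h := contDiff_normalizedVec (E := E) i₀
  unfold eigenEquation
  fun_prop

omit [Fintype ι] [FiniteDimensional ℝ E] in
theorem hasFDerivAt_normalizedVec (i₀ j : ι) (p : E × (ι → ℂ)) :
    HasFDerivAt (fun p : E × (ι → ℂ) => normalizedVec i₀ p.2 j)
      ((if j = i₀ then 0 else 1 : ℝ) •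
        ((ContinuousLinearMap.proj j : (ι → ℂ) →L[ℝ] ℂ) ∘L .snd ℝ E (ι → ℂ))) p := by
  unfold normalizedVec
  split_ifs
  · exact (hasFDerivAt_const _ _).congr_fderiv (by ext <;> simp)
  · rw [one_smul]
    exact ((ContinuousLinearMap.proj j : (ι → ℂ) →L[ℝ] ℂ) ∘L .snd ℝ E (ι → ℂ)).hasFDerivAt

theorem fderiv_eigenEquation_apply (W : E →ₗ[ℝ] Matrix ι ι ℂ) (d : ι → ℝ) (i₀ : ι)
    (h : E) (δ : ι → ℂ) (i : ι) :
    fderiv ℝ (eigenEquation W d i₀) (0, Pi.single i₀ (d i₀ : ℂ)) (h, δ) i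
      = W h i i₀ + (if i = i₀ then -1 else d i - d i₀ : ℝ) • δ i := by
  have hv := fun j => hasFDerivAt_normalizedVec (E := E) i₀ j (0, Pi.single i₀ (d i₀ : ℂ))
  have hω := fun j => ((LinearMap.toContinuousLinearMap
    (Matrix.entryLinearMap ℝ ℂ i j ∘ₗ W)) ∘L .fst ℝ E (ι → ℂ)).hasFDerivAt
      (x := ((0 : E), (Pi.single i₀ (d i₀ : ℂ) : ι → ℂ)))
  have hy := ((ContinuousLinearMap.proj i₀ : (ι → ℂ) →L[ℝ] ℂ) ∘L .snd ℝ E (ι → ℂ)).hasFDerivAt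
      (x := ((0 : E), (Pi.single i₀ (d i₀ : ℂ) : ι → ℂ)))
  have key := ((((hv i).const_mul (d i : ℂ))).add
    (HasFDerivAt.fun_sum fun j (_ : j ∈ Finset.univ) => (hω j).mul (hv j))).sub (hy.mul (hv i))
  have hdiff : DifferentiableAt ℝ (eigenEquation W d i₀) (0, Pi.single i₀ (d i₀ : ℂ)) :=
    (contDiff_eigenEquation W d i₀).differentiable (by norm_num) _
  have hi := (hasFDerivAt_pi'.1 hdiff.hasFDerivAt i).unique key
  have hi' := congrArg (fun f => f (h, δ)) hi
  refine Eq.trans hi' ?_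
  by_cases hii : i = i₀
  · subst hii
    simp [-ite_smul, -smul_ite, normalizedVec_single, sub_eq_add_neg, Finset.sum_add_distrib]
  · simp [-ite_smul, -smul_ite, normalizedVec_single, hii, Finset.sum_add_distrib]
    ring

theorem exists_contDiffAt_eigenvalue (W : E →ₗ[ℝ] Matrix ι ι ℂ) (d : ι → ℝ) {i₀ : ι}
    (hd : ∀ i, i ≠ i₀ → d i ≠ d i₀) :
    ∃ t : E → ℂ, ContDiffAt ℝ 2 t 0 ∧ t 0 = d i₀ ∧ (∀ h, fderiv ℝ t 0 h = W h i₀ i₀) ∧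
      ∀ᶠ x in 𝓝 (0 : E), ∃ v : ι → ℂ, v ≠ 0 ∧
        (diagonal (fun i => (d i : ℂ)) + W x) *ᵥ v = t x • v := by
  have : CompleteSpace E := FiniteDimensional.complete ℝ E
  let u : E × (ι → ℂ) := (0, Pi.single i₀ (d i₀ : ℂ))
  have hF : ContDiffAt ℝ 2 (eigenEquation W d i₀) u := (contDiff_eigenEquation W d i₀).contDiffAt
  have hκ : ∀ i, (if i = i₀ then -1 else d i - d i₀ : ℝ) ≠ 0 := by
    intro i
    split_ifs with h
    · norm_num
    · exact sub_ne_zero.2 (hd i h)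
  have hinv : (fderiv ℝ (eigenEquation W d i₀) u ∘L .inr ℝ E (ι → ℂ)).IsInvertible := by
    refine ⟨ContinuousLinearEquiv.piCongrRight fun i =>
      ContinuousLinearEquiv.smulLeft (Units.mk0 _ (hκ i)), ?_⟩
    ext δ i : 2
    have := fderiv_eigenEquation_apply W d i₀ 0 δ i
    simp only [map_zero, Matrix.zero_apply, zero_add] at this
    exact this.symm
  have h2 : (2 : WithTop ℕ∞) ≠ 0 := by norm_num
  let y := hF.implicitFunction h2 hinv
  have hy : ContDiffAt ℝ 2 y 0 := hF.contDiffAt_implicitFunction h2 hinv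
  have hy0 : y 0 = Pi.single i₀ (d i₀ : ℂ) := hF.implicitFunction_apply_self h2 hinv
  have hu : eigenEquation W d i₀ u = 0 := by
    ext i
    by_cases hi : i = i₀
    · subst hi; simp [eigenEquation, u, normalizedVec]
    · simp [eigenEquation, u, normalizedVec, hi]
  have hev : ∀ᶠ x in 𝓝 (0 : E), eigenEquation W d i₀ (x, y x) = 0 :=
    (hF.eventually_apply_implicitFunction h2 hinv).mono fun x hx => hx.trans hu
  refine ⟨fun x => y x i₀, contDiffAt_pi.1 hy i₀, by simp [hy0], fun h => ?_, ?_⟩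
  · have hyd : HasFDerivAt y (fderiv ℝ y 0) 0 := (hy.differentiableAt h2).hasFDerivAt
    have hcomp : HasFDerivAt (fun x => eigenEquation W d i₀ (x, y x))
        (fderiv ℝ (eigenEquation W d i₀) u ∘L
          ((ContinuousLinearMap.id ℝ E).prod (fderiv ℝ y 0))) 0 := by
      have hFd : HasFDerivAt (eigenEquation W d i₀) (fderiv ℝ (eigenEquation W d i₀) u)
          ((0 : E), y 0) := by
        rw [hy0]; exact (hF.differentiableAt h2).hasFDerivAt
      exact hFd.comp (0 : E) ((hasFDerivAt_id (0 : E)).prodMk hyd)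
    have hzero := hcomp.unique ((hasFDerivAt_const (0 : ι → ℂ) (0 : E)).congr_of_eventuallyEq hev)
    have h1 := congrFun (congrArg (fun f => f h) hzero) i₀
    have h3 := fderiv_eigenEquation_apply W d i₀ h (fderiv ℝ y 0 h) i₀
    have h4 : W h i₀ i₀ + (-1 : ℝ) • fderiv ℝ y 0 h i₀ = 0 := by
      rw [if_pos rfl] at h3
      exact h3.symm.trans h1
    have h5 : HasFDerivAt (fun x => y x i₀)
        ((ContinuousLinearMap.proj i₀ : (ι → ℂ) →L[ℝ] ℂ) ∘L fderiv ℝ y 0) 0 :=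
      hasFDerivAt_pi'.1 hyd i₀
    rw [h5.fderiv]
    simp only [neg_smul, one_smul] at h4
    exact (add_neg_eq_zero.1 h4).symm
  · filter_upwards [hev] with x hx
    refine ⟨normalizedVec i₀ (y x), fun h => ?_, ?_⟩
    · simpa [normalizedVec] using congrFun h i₀
    · rw [eigenEquation_eq] at hx
      exact sub_eq_zero.1 hx

end SmoothEigenvalue

section SmoothGap

variable {ι : Type*} [Fintype ι]

theorem norm_star_dotProduct_mulVec_le (M : Matrix ι ι ℂ) (w : ι → ℂ) :
    ‖star w ⬝ᵥ M *ᵥ w‖ ≤ (∑ i, ∑ j, ‖M i j‖) * ∑ i, ‖w i‖ ^ 2 := by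
  have hle : ∀ i, ‖w i‖ ^ 2 ≤ ∑ i, ‖w i‖ ^ 2 := fun i =>
    Finset.single_le_sum (f := fun i => ‖w i‖ ^ 2) (fun _ _ => by positivity) (Finset.mem_univ i)
  rw [Finset.sum_mul]
  refine (norm_sum_le _ _).trans (Finset.sum_le_sum fun i _ => ?_)
  rw [Matrix.mulVec, dotProduct, Finset.mul_sum, Finset.sum_mul]
  refine (norm_sum_le _ _).trans (Finset.sum_le_sum fun j _ => ?_)
  rw [norm_mul, norm_mul, Pi.star_apply, norm_star, mul_left_comm]
  refine mul_le_mul_of_nonneg_left ?_ (norm_nonneg _)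
  nlinarith [hle i, hle j, sq_nonneg (‖w i‖ - ‖w j‖)]

variable [DecidableEq ι]
  {E : Type*} [NormedAddCommGroup E] [NormedSpace ℝ E] [FiniteDimensional ℝ E]

theorem exists_contDiffAt_specGap (W : E →ₗ[ℝ] Matrix ι ι ℂ) (hW : ∀ x, (W x).IsHermitian)
    (d : ι → ℝ) {i₀ i₁ : ι} (hd₁ : d i₁ = d i₀ + 1)
    (hd₂ : ∀ i, i ≠ i₀ → i ≠ i₁ → d i₀ + 2 ≤ d i) :
    ∃ g : E → ℝ, ContDiffAt ℝ 2 g 0 ∧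
      (∀ h, fderiv ℝ g 0 h = (W h i₁ i₁).re - (W h i₀ i₀).re) ∧
      ∀ᶠ x in 𝓝 (0 : E), ∀ ν : ℝ, 0 < ν →
        specGap ((ν : ℂ) • (diagonal (fun i => (d i : ℂ)) + W x)) = ν * g x := by
  obtain ⟨t₀, ht₀, ht₀0, ht₀d, ht₀e⟩ := exists_contDiffAt_eigenvalue W d (i₀ := i₀) (by
    intro i hi
    by_cases h : i = i₁
    · rw [h, hd₁]; linarith
    · linarith [hd₂ i hi h])
  obtain ⟨t₁, ht₁, ht₁0, ht₁d, ht₁e⟩ := exists_contDiffAt_eigenvalue W d (i₀ := i₁) (by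
    intro i hi
    by_cases h : i = i₀
    · rw [h, hd₁]; linarith
    · linarith [hd₂ i h hi])
  have hre : ∀ t : E → ℂ, ContDiffAt ℝ 2 t 0 → ContDiffAt ℝ 2 (fun x => (t x).re) 0 ∧
      HasFDerivAt (fun x => (t x).re) (Complex.reCLM ∘L fderiv ℝ t 0) 0 := fun t ht =>
    ⟨Complex.reCLM.contDiff.contDiffAt.comp (0 : E) ht,
      Complex.reCLM.hasFDerivAt.comp (0 : E) (ht.differentiableAt (by norm_num)).hasFDerivAt⟩
  obtain ⟨hr₀, hf₀⟩ := hre t₀ ht₀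
  obtain ⟨hr₁, hf₁⟩ := hre t₁ ht₁
  refine ⟨fun x => (t₁ x).re - (t₀ x).re, hr₁.sub hr₀, fun h => ?_, ?_⟩
  · rw [(hf₁.fun_sub hf₀).fderiv]
    simp [ht₀d, ht₁d]
  have hlow : ∀ᶠ x in 𝓝 (0 : E), (t₀ x).re < d i₀ + 1 / 2 :=
    hr₀.continuousAt.eventually_lt_const (by simp [ht₀0])
  have hmid : ∀ᶠ x in 𝓝 (0 : E), d i₀ + 1 / 2 < (t₁ x).re :=
    hr₁.continuousAt.eventually_const_lt (by simp [ht₁0, hd₁]; norm_num)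
  have hhigh : ∀ᶠ x in 𝓝 (0 : E), (t₁ x).re < d i₀ + 3 / 2 :=
    hr₁.continuousAt.eventually_lt_const (by simp [ht₁0, hd₁]; norm_num)
  have hsmall : ∀ᶠ x in 𝓝 (0 : E), ∑ i, ∑ j, ‖W x i j‖ < 1 / 2 := by
    have hcont : Continuous fun x => ∑ i, ∑ j, ‖W x i j‖ :=
      continuous_finsetSum _ fun i _ => continuous_finsetSum _ fun j _ =>
        (LinearMap.continuous_of_finiteDimensional (Matrix.entryLinearMap ℝ ℂ i j ∘ₗ W)).norm
    exact hcont.continuousAt.eventually_lt_const (by simp)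
  filter_upwards [ht₀e, ht₁e, hlow, hmid, hhigh, hsmall] with x ⟨v₀, hv₀, he₀⟩ ⟨v₁, hv₁, he₁⟩
    hlow hmid hhigh hsmall ν hν
  have hB : (diagonal (fun i => (d i : ℂ)) + W x).IsHermitian :=
    (isHermitian_diagonal_of_self_adjoint _ (by ext i; simp)).add (hW x)
  have hA : ((ν : ℂ) • (diagonal (fun i => (d i : ℂ)) + W x)).IsHermitian := by
    rw [IsHermitian, conjTranspose_smul, hB.eq]; simp
  have hform : ∀ w : ι → ℂ, w i₀ = 0 → w i₁ = 0 → ν * (d i₀ + 3 / 2) * ∑ i, ‖w i‖ ^ 2 ≤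
      (star w ⬝ᵥ ((ν : ℂ) • (diagonal (fun i => (d i : ℂ)) + W x)) *ᵥ w).re := by
    intro w hw₀ hw₁
    have hdiag : (star w ⬝ᵥ diagonal (fun i => (d i : ℂ)) *ᵥ w).re = ∑ i, d i * ‖w i‖ ^ 2 := by
      rw [← Complex.ofReal_re (∑ i, d i * ‖w i‖ ^ 2)]
      congr 1
      simp only [dotProduct, mulVec_diagonal, Pi.star_apply, RCLike.star_def]
      push_cast
      refine Finset.sum_congr rfl fun i _ => ?_
      rw [mul_left_comm, Complex.conj_mul']
    have hd : (d i₀ + 2) * ∑ i, ‖w i‖ ^ 2 ≤ ∑ i, d i * ‖w i‖ ^ 2 := by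
      rw [Finset.mul_sum]
      refine Finset.sum_le_sum fun i _ => ?_
      by_cases h₀ : i = i₀
      · simp [h₀, hw₀]
      by_cases h₁ : i = i₁
      · simp [h₁, hw₁]
      exact mul_le_mul_of_nonneg_right (hd₂ i h₀ h₁) (by positivity)
    have hWx : -(1 / 2 * ∑ i, ‖w i‖ ^ 2) ≤ (star w ⬝ᵥ W x *ᵥ w).re := by
      refine neg_le_of_abs_le ((Complex.abs_re_le_norm _).trans
        ((norm_star_dotProduct_mulVec_le _ _).trans ?_))
      exact mul_le_mul_of_nonneg_right hsmall.le (by positivity)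
    rw [smul_mulVec, dotProduct_smul, smul_eq_mul, Complex.re_ofReal_mul, add_mulVec,
      dotProduct_add, Complex.add_re, hdiag, mul_assoc]
    refine mul_le_mul_of_nonneg_left ?_ hν.le
    linarith
  have hsm : ∀ {v : ι → ℂ} {t : ℂ}, (diagonal (fun i => (d i : ℂ)) + W x) *ᵥ v = t • v →
      ((ν : ℂ) • (diagonal (fun i => (d i : ℂ)) + W x)) *ᵥ v = ((ν : ℂ) * t) • v := by
    intro v t h
    rw [smul_mulVec, h, smul_smul]
  rw [specGap_eq_sub hA hform hv₀ hv₁ (hsm he₀) (hsm he₁), Complex.re_ofReal_mul,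
    Complex.re_ofReal_mul, mul_sub]
  · rw [Complex.re_ofReal_mul, Complex.re_ofReal_mul]
    exact mul_lt_mul_of_pos_left (hlow.trans hmid) hν
  · rw [Complex.re_ofReal_mul]
    exact mul_lt_mul_of_pos_left hhigh hν

end SmoothGap

section Tensor

variable {n : ℕ}

/-- The tensor product of `n` single-qubit matrices. -/
def tensor (M : Fin n → Matrix (Fin 2) (Fin 2) ℂ) : Matrix (Fin n → Fin 2) (Fin n → Fin 2) ℂ :=
  fun x y => ∏ j, M j (x j) (y j)

theorem pauliString_eq_tensor (a : Fin n → Fin 4) :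
    pauliString a = tensor fun j => pauli (a j) := rfl

theorem tensor_mul (M N : Fin n → Matrix (Fin 2) (Fin 2) ℂ) :
    tensor M * tensor N = tensor fun j => M j * N j := by
  ext x y
  simp only [tensor, Matrix.mul_apply, ← Finset.prod_mul_distrib]
  rw [Finset.prod_univ_sum, Fintype.piFinset_univ]

theorem tensor_diagonal (D : Fin n → Fin 2 → ℂ) :
    tensor (fun j => diagonal (D j)) = diagonal fun t => ∏ j, D j (t j) := by
  ext x y
  by_cases h : x = y
  · simp [tensor, h]
  · obtain ⟨j, hj⟩ := Function.ne_iff.1 h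
    rw [diagonal_apply_ne _ h]
    exact Finset.prod_eq_zero (Finset.mem_univ j) (diagonal_apply_ne _ hj)

theorem tensor_one : tensor (fun _ : Fin n => (1 : Matrix (Fin 2) (Fin 2) ℂ)) = 1 := by
  have := tensor_diagonal (n := n) fun _ _ => 1
  simpa using this

theorem tensor_conjTranspose (M : Fin n → Matrix (Fin 2) (Fin 2) ℂ) :
    (tensor M)ᴴ = tensor fun j => (M j)ᴴ := by
  ext x y
  simp [tensor, Matrix.conjTranspose_apply]

theorem pauli_isHermitian (a : Fin 4) : (pauli a).IsHermitian := by
  fin_cases a <;> ext i j <;> fin_cases i <;> fin_cases j <;> simp [pauli]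

theorem pauliString_isHermitian (a : Fin n → Fin 4) : (pauliString a).IsHermitian := by
  rw [IsHermitian, pauliString_eq_tensor, tensor_conjTranspose]
  simp only [(pauli_isHermitian _).eq]

theorem Hmat_isHermitian (lam : PIdx n → ℝ) : (Hmat lam).IsHermitian := by
  rw [IsHermitian, Hmat, Matrix.conjTranspose_sum]
  simp [(pauliString_isHermitian _).eq]

/-- A unitary whose columns are eigenvectors of the Pauli matrix `σ^(b+1)`. -/
noncomputable def pauliBasis : Fin 3 → Matrix (Fin 2) (Fin 2) ℂ
  | 0 => !![⟨1/2, 1/2⟩, ⟨1/2, 1/2⟩; ⟨1/2, 1/2⟩, ⟨-1/2, -1/2⟩]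
  | 1 => !![⟨1/2, 1/2⟩, ⟨1/2, 1/2⟩; ⟨-1/2, 1/2⟩, ⟨1/2, -1/2⟩]
  | 2 => 1

theorem pauliBasis_conjTranspose_mul (b : Fin 3) : (pauliBasis b)ᴴ * pauliBasis b = 1 := by
  fin_cases b <;> ext i j <;> fin_cases i <;> fin_cases j <;>
    simp [pauliBasis, Matrix.mul_apply, Complex.ext_iff] <;> norm_num

theorem pauliBasis_conj_pauli (b : Fin 3) :
    (pauliBasis b)ᴴ * pauli b.succ * pauliBasis b
      = diagonal fun t : Fin 2 => (-1 : ℂ) ^ (t : ℕ) := by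
  fin_cases b <;> ext i j <;> fin_cases i <;> fin_cases j <;>
    simp [pauliBasis, pauli, Matrix.mul_apply, Complex.ext_iff] <;> norm_num

/-- The diagonal entry at `t` of `σ^a` in the eigenbasis of `σ^(b+1)`. -/
noncomputable def pauliDiag (a : Fin 4) (b : Fin 3) (t : Fin 2) : ℝ :=
  if a = 0 then 1 else if a = b.succ then (-1) ^ (t : ℕ) else 0

theorem pauliBasis_conj_apply_self (a : Fin 4) (b : Fin 3) (t : Fin 2) :
    ((pauliBasis b)ᴴ * pauli a * pauliBasis b) t t = (pauliDiag a b t : ℂ) := by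
  fin_cases b <;> fin_cases a <;> fin_cases t <;>
    simp [pauliBasis, pauli, pauliDiag, Matrix.mul_apply, Complex.ext_iff] <;> norm_num

/-- The product unitary diagonalizing the control Hamiltonian. -/
noncomputable def prodBasis (β : Fin n → Fin 3) : Matrix (Fin n → Fin 2) (Fin n → Fin 2) ℂ :=
  tensor fun j => pauliBasis (β j)

theorem prodBasis_mul_conjTranspose (β : Fin n → Fin 3) :
    prodBasis β * (prodBasis β)ᴴ = 1 := by
  rw [mul_eq_one_comm, prodBasis, tensor_conjTranspose, tensor_mul]
  simp only [pauliBasis_conjTranspose_mul, tensor_one]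

theorem prodBasis_conj_pauliString (β : Fin n → Fin 3) (a : Fin n → Fin 4) :
    (prodBasis β)ᴴ * pauliString a * prodBasis β
      = tensor fun j => (pauliBasis (β j))ᴴ * pauli (a j) * pauliBasis (β j) := by
  rw [pauliString_eq_tensor, prodBasis, tensor_conjTranspose, tensor_mul, tensor_mul]

theorem prodBasis_conj_pauliAt (β : Fin n → Fin 3) (j : Fin n) :
    (prodBasis β)ᴴ * pauliAt j (β j) * prodBasis β
      = diagonal fun t : Fin n → Fin 2 => (-1 : ℂ) ^ (t j : ℕ) := by
  have h : ∀ i, (pauliBasis (β i))ᴴ * pauli (if i = j then (β j).succ else 0) * pauliBasis (β i)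
      = diagonal fun t : Fin 2 => if i = j then (-1 : ℂ) ^ (t : ℕ) else 1 := by
    intro i
    split_ifs with hi
    · rw [hi, pauliBasis_conj_pauli]
    · rw [show pauli 0 = 1 from rfl, mul_one, pauliBasis_conjTranspose_mul, diagonal_one]
  rw [pauliAt, prodBasis_conj_pauliString]
  simp only [h, tensor_diagonal]
  simp

/-- The energies of the control Hamiltonian. -/
noncomputable def ctrlEnergy (k : Fin n) (s t : Fin n → Fin 2) : ℝ :=
  (∑ j ∈ Finset.univ.erase k, (if s j = t j then 1 else -1)) + (if s k = t k then 1 else -1) / 2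

theorem neg_one_pow_mul_neg_one_pow (p q : Fin 2) :
    (-1 : ℂ) ^ (p : ℕ) * (-1) ^ (q : ℕ) = if p = q then 1 else -1 := by
  fin_cases p <;> fin_cases q <;> simp

theorem prodBasis_conj_Hctrl (k : Fin n) (s : Fin n → Fin 2) (β : Fin n → Fin 3) :
    (prodBasis β)ᴴ * Hctrl k s β * prodBasis β
      = diagonal fun t => (ctrlEnergy k s t : ℂ) := by
  rw [Hctrl, Matrix.mul_add, Matrix.add_mul, Finset.mul_sum, Finset.sum_mul]
  simp only [Matrix.mul_smul, Matrix.smul_mul, prodBasis_conj_pauliAt]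
  ext x y
  by_cases h : x = y
  · subst h
    simp [ctrlEnergy, Matrix.sum_apply, neg_one_pow_mul_neg_one_pow, div_mul_eq_mul_div,
      apply_ite (Complex.ofReal)]
  · simp [Matrix.sum_apply, h]

theorem Hctrl_isHermitian (k : Fin n) (s : Fin n → Fin 2) (β : Fin n → Fin 3) :
    (Hctrl k s β).IsHermitian := by
  have h : ∀ p : ℕ, star ((-1 : ℂ) ^ p) = (-1) ^ p := fun p => by simp
  rw [IsHermitian, Hctrl, conjTranspose_add, conjTranspose_sum, conjTranspose_smul]
  simp only [conjTranspose_smul, pauliAt, (pauliString_isHermitian _).eq, h, star_div₀]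
  simp

theorem flip_eq_neg (p q : Fin 2) :
    (if p = q + 1 then 1 else -1 : ℝ) = -(if p = q then 1 else -1) := by
  fin_cases p <;> fin_cases q <;> simp

theorem ctrlEnergy_flip (k : Fin n) (s : Fin n → Fin 2) :
    ctrlEnergy k s (Function.update s k (s k + 1)) = ctrlEnergy k s s - 1 := by
  have h : ∑ j ∈ Finset.univ.erase k,
      (if s j = Function.update s k (s k + 1) j then 1 else -1 : ℝ)
        = ∑ j ∈ Finset.univ.erase k, (if s j = s j then 1 else -1) :=
    Finset.sum_congr rfl fun j hj => by rw [Function.update_of_ne (Finset.ne_of_mem_erase hj)]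
  rw [ctrlEnergy, ctrlEnergy, h, Function.update_self, flip_eq_neg]
  simp; ring

theorem ctrlEnergy_le (k : Fin n) {s t : Fin n → Fin 2} (h₀ : t ≠ s)
    (h₁ : t ≠ Function.update s k (s k + 1)) : ctrlEnergy k s t ≤ ctrlEnergy k s s - 2 := by
  obtain ⟨j, hjk, hj⟩ : ∃ j, j ≠ k ∧ s j ≠ t j := by
    by_contra! hall
    have hk : t = Function.update s k (t k) := by
      ext1 j
      by_cases hjk : j = k
      · rw [hjk, Function.update_self]
      · rw [Function.update_of_ne hjk, hall j hjk]
    rcases (by generalize t k = p; generalize s k = q; fin_cases p <;> fin_cases q <;> simp :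
      t k = s k ∨ t k = s k + 1) with h | h
    · exact h₀ (by rw [hk, h, Function.update_eq_self])
    · exact h₁ (by rw [← h, ← hk])
  have hjm : j ∈ Finset.univ.erase k := Finset.mem_erase.2 ⟨hjk, Finset.mem_univ j⟩
  have hle : ∑ i ∈ (Finset.univ.erase k).erase j, (if s i = t i then 1 else -1 : ℝ)
      ≤ ∑ i ∈ (Finset.univ.erase k).erase j, (if s i = s i then 1 else -1) :=
    Finset.sum_le_sum fun i _ => by simp only [if_true]; split_ifs <;> norm_num
  have hk : (if s k = t k then 1 else -1 : ℝ) ≤ 1 := by split_ifs <;> norm_num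
  have hsplit : ∀ f : Fin n → ℝ, ∑ i ∈ Finset.univ.erase k, f i
      = f j + ∑ i ∈ (Finset.univ.erase k).erase j, f i := fun f =>
    (Finset.add_sum_erase _ f hjm).symm
  rw [ctrlEnergy, ctrlEnergy, hsplit, hsplit, if_neg hj, if_pos rfl, if_pos rfl]
  generalize (∑ i ∈ (Finset.univ.erase k).erase j, if s i = t i then (1 : ℝ) else -1) = T at *
  generalize (∑ i ∈ (Finset.univ.erase k).erase j, if s i = s i then (1 : ℝ) else -1) = S at *
  generalize (if s k = t k then (1 : ℝ) else -1) = e at *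
  linarith

/-- The matrix of `H(x)` in the eigenbasis of the control Hamiltonian. -/
noncomputable def rotatedHmat (β : Fin n → Fin 3) :
    EuclideanSpace ℝ (PIdx n) →ₗ[ℝ] Matrix (Fin n → Fin 2) (Fin n → Fin 2) ℂ where
  toFun x := (prodBasis β)ᴴ * Hmat x * prodBasis β
  map_add' x y := by
    simp [Hmat, add_smul, Finset.sum_add_distrib, Matrix.mul_add, Matrix.add_mul]
  map_smul' c x := by
    have h : Hmat ((c • x : EuclideanSpace ℝ (PIdx n)) : PIdx n → ℝ) = c • Hmat x := by
      ext i j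
      simp [Hmat, Matrix.sum_apply, Finset.mul_sum, mul_assoc]
    rw [h]
    simp

theorem rotatedHmat_apply_self_re (β : Fin n → Fin 3) (x : EuclideanSpace ℝ (PIdx n))
    (t : Fin n → Fin 2) :
    (rotatedHmat β x t t).re = ∑ a : PIdx n, x a * ∏ j, pauliDiag (a.1 j) (β j) (t j) := by
  have h : rotatedHmat β x
      = ∑ a : PIdx n, (x a : ℂ) • ((prodBasis β)ᴴ * pauliString a.1 * prodBasis β) := by
    simp [rotatedHmat, Hmat, Finset.mul_sum, Finset.sum_mul]
  rw [h]
  simp only [prodBasis_conj_pauliString, Matrix.sum_apply, Matrix.smul_apply, tensor,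
    pauliBasis_conj_apply_self, smul_eq_mul, ← Complex.ofReal_prod, ← Complex.ofReal_mul,
    ← Complex.ofReal_sum, Complex.ofReal_re]

theorem Egap_smul (x : EuclideanSpace ℝ (PIdx n)) (ν : ℝ) (k : Fin n) (s : Fin n → Fin 2)
    (β : Fin n → Fin 3) :
    Egap (ν • x : EuclideanSpace ℝ (PIdx n)) ν k s β
      = specGap ((ν : ℂ) • (diagonal (fun t => ((-ctrlEnergy k s t : ℝ) : ℂ))
          + rotatedHmat β x)) := by
  have hH : Htot (ν • x : EuclideanSpace ℝ (PIdx n)) ν k s β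
      = (ν : ℂ) • (Hmat x - Hctrl k s β) := by
    rw [Htot, smul_sub]
    congr 1
    simp [Hmat, Finset.smul_sum, mul_smul]
  have hHerm : (Htot (ν • x : EuclideanSpace ℝ (PIdx n)) ν k s β).IsHermitian := by
    rw [hH, IsHermitian, conjTranspose_smul,
      ((Hmat_isHermitian _).sub (Hctrl_isHermitian k s β)).eq]
    simp
  have hE : Egap (ν • x : EuclideanSpace ℝ (PIdx n)) ν k s β
      = specGap (Htot (ν • x : EuclideanSpace ℝ (PIdx n)) ν k s β) := by
    simp only [Egap, specGap]
    congr!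
  rw [hE, ← specGap_unitary_conj (prodBasis_mul_conjTranspose β) hHerm, hH]
  congr 1
  rw [Matrix.mul_smul, Matrix.smul_mul, Matrix.mul_sub, Matrix.sub_mul, prodBasis_conj_Hctrl,
    sub_eq_neg_add]
  congr 2
  ext i j
  by_cases h : i = j <;> simp [h]

theorem prod_pauliDiag_flip (a : Fin n → Fin 4) (β : Fin n → Fin 3) (k : Fin n)
    (s : Fin n → Fin 2) :
    ∏ j, pauliDiag (a j) (β j) (Function.update s k (s k + 1) j)
      = (if a k = 0 then 1 else -1) * ∏ j, pauliDiag (a j) (β j) (s j) := by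
  have hflip : ∀ (c : Fin 4) (b : Fin 3) (t : Fin 2),
      pauliDiag c b (t + 1) = (if c = 0 then 1 else -1) * pauliDiag c b t := by
    intro c b t
    unfold pauliDiag
    split_ifs <;> fin_cases t <;> simp
  have hk := Finset.mem_univ k
  rw [← Finset.mul_prod_erase _ _ hk, ← Finset.mul_prod_erase _ _ hk, Function.update_self, hflip,
    mul_assoc]
  congr 2
  exact Finset.prod_congr rfl fun j hj => by rw [Function.update_of_ne (Finset.ne_of_mem_erase hj)]

theorem exists_contDiffAt_Egap (p : EIdx n) :
    ∃ g : EuclideanSpace ℝ (PIdx n) → ℝ, ContDiffAt ℝ 2 g 0 ∧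
      (∀ h, fderiv ℝ g 0 h = ∑ a : PIdx n, h a *
        ((if a.1 p.1 = 0 then 0 else -2) * ∏ j, pauliDiag (a.1 j) (p.2.2 j) (p.2.1 j))) ∧
      ∀ᶠ x in 𝓝 (0 : EuclideanSpace ℝ (PIdx n)), ∀ ν : ℝ, 0 < ν →
        Egap (ν • x : EuclideanSpace ℝ (PIdx n)) ν p.1 p.2.1 p.2.2 = ν * g x := by
  obtain ⟨k, s, β⟩ := p
  obtain ⟨g, hg, hgd, hge⟩ := exists_contDiffAt_specGap (rotatedHmat β)
    (fun x => isHermitian_conjTranspose_mul_mul _ (Hmat_isHermitian _))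
    (fun t => -ctrlEnergy k s t) (i₀ := s) (i₁ := Function.update s k (s k + 1))
    (by rw [ctrlEnergy_flip]; ring) (fun t h₀ h₁ => by linarith [ctrlEnergy_le k h₀ h₁])
  refine ⟨g, hg, fun h => ?_, ?_⟩
  · rw [hgd, rotatedHmat_apply_self_re, rotatedHmat_apply_self_re, ← Finset.sum_sub_distrib]
    refine Finset.sum_congr rfl fun a _ => ?_
    rw [prod_pauliDiag_flip]
    split_ifs <;> ring
  · filter_upwards [hge] with x hx ν hν
    rw [Egap_smul, hx ν hν]

end Tensor

section Orthogonality

variable {n : ℕ}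

theorem sum_pauliDiag_mul (a b : Fin 4) (c : Fin 3) :
    ∑ t, pauliDiag a c t * pauliDiag b c t = if a = b ∧ (a = 0 ∨ a = c.succ) then 2 else 0 := by
  fin_cases a <;> fin_cases b <;> fin_cases c <;> simp [pauliDiag] <;> norm_num

theorem sum_prod_pauliDiag_mul (a b : Fin n → Fin 4) (β : Fin n → Fin 3) :
    ∑ s : Fin n → Fin 2, (∏ j, pauliDiag (a j) (β j) (s j)) * ∏ j, pauliDiag (b j) (β j) (s j)
      = if a = b then (if ∀ j, a j = 0 ∨ a j = (β j).succ then 2 ^ n else 0) else 0 := by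
  have h : ∑ s : Fin n → Fin 2,
      (∏ j, pauliDiag (a j) (β j) (s j)) * ∏ j, pauliDiag (b j) (β j) (s j)
        = ∏ j, ∑ t, pauliDiag (a j) (β j) t * pauliDiag (b j) (β j) t := by
    simp only [← Finset.prod_mul_distrib]
    rw [Finset.prod_univ_sum, Fintype.piFinset_univ]
  rw [h]
  simp only [sum_pauliDiag_mul]
  split_ifs with hab hc
  · subst hab
    simp [hc]
  · obtain ⟨j, hj⟩ := not_forall.1 hc
    exact Finset.prod_eq_zero (Finset.mem_univ j) (if_neg fun h => hj h.2)
  · obtain ⟨j, hj⟩ := Function.ne_iff.1 hab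
    exact Finset.prod_eq_zero (Finset.mem_univ j) (if_neg fun h => hj h.1)

theorem sum_sq_sum_pauliDiag (u : PIdx n → ℝ) (β : Fin n → Fin 3) :
    ∑ s : Fin n → Fin 2, (∑ a, u a * ∏ j, pauliDiag (a.1 j) (β j) (s j)) ^ 2
      = ∑ a : PIdx n, if ∀ j, a.1 j = 0 ∨ a.1 j = (β j).succ then 2 ^ n * u a ^ 2 else 0 := by
  simp only [sq (∑ a, _), Finset.sum_mul_sum]
  rw [Finset.sum_comm]
  refine Finset.sum_congr rfl fun a _ => ?_
  rw [Finset.sum_comm]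
  simp only [mul_mul_mul_comm, ← Finset.mul_sum, sum_prod_pauliDiag_mul]
  rw [Finset.sum_eq_single a]
  · rw [if_pos rfl]
    split_ifs <;> ring
  · intro b _ hb
    rw [if_neg fun h => hb (Subtype.ext h.symm), mul_zero]
  · simp

theorem le_sum_sq_gap_derivative (v : PIdx n → ℝ) :
    2 ^ (n + 2) * ∑ a, v a ^ 2 ≤ ∑ p : EIdx n, (∑ a : PIdx n, v a *
      ((if a.1 p.1 = 0 then 0 else -2) * ∏ j, pauliDiag (a.1 j) (p.2.2 j) (p.2.1 j))) ^ 2 := by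
  have hsum : ∑ p : EIdx n, (∑ a : PIdx n, v a *
      ((if a.1 p.1 = 0 then 0 else -2) * ∏ j, pauliDiag (a.1 j) (p.2.2 j) (p.2.1 j))) ^ 2
      = ∑ a : PIdx n, ∑ q : Fin n × (Fin n → Fin 3),
        if ∀ j, a.1 j = 0 ∨ a.1 j = (q.2 j).succ then
          2 ^ n * (v a * if a.1 q.1 = 0 then 0 else -2) ^ 2 else 0 := by
    rw [Finset.sum_comm, Fintype.sum_prod_type, Fintype.sum_prod_type]
    refine Finset.sum_congr rfl fun k _ => ?_
    rw [Fintype.sum_prod_type, Finset.sum_comm]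
    refine Finset.sum_congr rfl fun β _ => ?_
    simp only [← mul_assoc (v _)]
    exact sum_sq_sum_pauliDiag (fun a => v a * if a.1 k = 0 then 0 else -2) β
  rw [hsum, Finset.mul_sum]
  refine Finset.sum_le_sum fun a _ => ?_
  obtain ⟨k, hk⟩ := Function.ne_iff.1 a.2
  have hβ : ∀ j, ∃ b : Fin 3, a.1 j = 0 ∨ a.1 j = b.succ := by
    intro j
    rcases Fin.eq_zero_or_eq_succ (a.1 j) with h | ⟨b, h⟩
    · exact ⟨0, Or.inl h⟩
    · exact ⟨b, Or.inr h⟩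
  choose β hβ using hβ
  refine le_trans (le_of_eq ?_) (Finset.single_le_sum (fun q _ => ?_)
    (Finset.mem_univ ((k, β) : Fin n × (Fin n → Fin 3))))
  · rw [if_pos hβ, if_neg hk]
    ring
  · split_ifs <;> positivity

end Orthogonality

section Hessian

variable {X Y E : Type*} [NormedAddCommGroup X] [NormedSpace ℝ X] [NormedAddCommGroup E]
  [NormedSpace ℝ E]

theorem fderiv_fderiv_comp_affine {f : X → ℝ} (a : X) (L : E →L[ℝ] X) {x : E}
    (hf : ContDiffAt ℝ 2 f (a + L x)) (v w : E) :
    fderiv ℝ (fderiv ℝ fun y => f (a + L y)) x v w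
      = fderiv ℝ (fderiv ℝ f) (a + L x) (L v) (L w) := by
  have hA : ∀ y, HasFDerivAt (fun y => a + L y) L y := fun y => L.hasFDerivAt.const_add a
  have hev : ∀ᶠ y in 𝓝 x, ContDiffAt ℝ 2 f (a + L y) :=
    (hA x).continuousAt.eventually (hf.eventually (by simp))
  have h1 : (fderiv ℝ fun y => f (a + L y)) =ᶠ[𝓝 x] fun y => (fderiv ℝ f (a + L y)).comp L := by
    filter_upwards [hev] with y hy
    exact ((hy.differentiableAt (by norm_num)).hasFDerivAt.comp y (hA y)).fderiv
  have h2 : DifferentiableAt ℝ (fderiv ℝ f) (a + L x) :=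
    (hf.fderiv_right (m := 1) (by norm_num)).differentiableAt (by norm_num)
  have h3 := (h2.hasFDerivAt.comp x (hA x)).clm_comp (hasFDerivAt_const L x)
  rw [h1.fderiv_eq]
  have h4 := h3.fderiv
  simp only [Function.comp_def] at h4
  rw [h4]
  simp

theorem eventually_abs_hessian_sub_le {f : X → ℝ} {x : X} (hf : ContDiffAt ℝ 2 f x) {ε : ℝ}
    (hε : 0 < ε) : ∀ᶠ y in 𝓝 x, ∀ v,
      |fderiv ℝ (fderiv ℝ f) y v v - fderiv ℝ (fderiv ℝ f) x v v| ≤ ε * ‖v‖ ^ 2 := by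
  have hcont : ContinuousAt (fderiv ℝ (fderiv ℝ f)) x :=
    ((hf.fderiv_right (m := 1) (by norm_num)).fderiv_right (m := 0) (by norm_num)).continuousAt
  have hsub := (tendsto_iff_norm_sub_tendsto_zero (E := X →L[ℝ] X →L[ℝ] ℝ)).1 hcont
  filter_upwards [hsub.eventually_lt_const hε] with y hy v
  have hop := (fderiv ℝ (fderiv ℝ f) y - fderiv ℝ (fderiv ℝ f) x).le_opNorm₂ v v
  rw [mul_assoc, ← sq] at hop
  exact hop.trans (mul_le_mul_of_nonneg_right hy.le (sq_nonneg _))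

variable [NormedAddCommGroup Y] [InnerProductSpace ℝ Y]

theorem fderiv_fderiv_half_norm_sq {R : X → Y} {z : X} (hR : ContDiffAt ℝ 2 R z) (hz : R z = 0)
    (h : X) : fderiv ℝ (fderiv ℝ fun w => 1 / 2 * ‖R w‖ ^ 2) z h h = ‖fderiv ℝ R z h‖ ^ 2 := by
  have h1 : (fderiv ℝ fun w => 1 / 2 * ‖R w‖ ^ 2)
      =ᶠ[𝓝 z] fun w => (innerSL ℝ (R w)).comp (fderiv ℝ R w) := by
    filter_upwards [hR.eventually (by simp)] with w hw
    rw [((hw.differentiableAt (by norm_num)).hasFDerivAt.norm_sq.const_mul (1 / 2)).fderiv]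
    ext y
    simp
  have h2 : DifferentiableAt ℝ (fderiv ℝ R) z :=
    (hR.fderiv_right (m := 1) (by norm_num)).differentiableAt (by norm_num)
  have h3 := (((innerSL ℝ : Y →L[ℝ] Y →L[ℝ] ℝ).hasFDerivAt.comp z
    (hR.differentiableAt (by norm_num)).hasFDerivAt).clm_comp h2.hasFDerivAt).fderiv
  simp only [Function.comp_def] at h3
  rw [h1.fderiv_eq, h3]
  simp only [hz, map_zero, ContinuousLinearMap.zero_comp, zero_add, ContinuousLinearMap.comp_apply,
    ContinuousLinearMap.flip_apply, ContinuousLinearMap.compL_apply]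
  exact real_inner_self_eq_norm_sq _

theorem eventually_le_hessian_least_squares {G : E → Y} (hG : ContDiffAt ℝ 2 G 0) {K K' : ℝ}
    (hK : K' < K) (hlow : ∀ v, K * ‖v‖ ^ 2 ≤ ‖fderiv ℝ G 0 v‖ ^ 2) :
    ∀ᶠ z in 𝓝 ((G 0, 0) : Y × E),
      ContDiffAt ℝ 2 (fun z : Y × E => 1 / 2 * ‖z.1 - G z.2‖ ^ 2) z ∧
      ∀ v : E, K' * ‖v‖ ^ 2 ≤
        fderiv ℝ (fderiv ℝ fun z : Y × E => 1 / 2 * ‖z.1 - G z.2‖ ^ 2) z (0, v) (0, v) := by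
  let z₀ : Y × E := (G 0, 0)
  have hG₀ : ContDiffAt ℝ 2 (fun z : Y × E => G z.2) z₀ :=
    ContDiffAt.comp z₀ (g := G) (f := Prod.snd) hG contDiffAt_snd
  have hR : ContDiffAt ℝ 2 (fun z : Y × E => z.1 - G z.2) z₀ := contDiffAt_fst.sub hG₀
  have hΨ : ContDiffAt ℝ 2 (fun z : Y × E => 1 / 2 * ‖z.1 - G z.2‖ ^ 2) z₀ :=
    contDiffAt_const.mul (hR.norm_sq ℝ)
  filter_upwards [hΨ.eventually (by simp),
    eventually_abs_hessian_sub_le hΨ (sub_pos.2 hK)] with z hz hclose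
  refine ⟨hz, fun v => ?_⟩
  have h0 := fderiv_fderiv_half_norm_sq hR (sub_self (G 0)) ((0, v) : Y × E)
  have hd : HasFDerivAt (fun z : Y × E => z.1 - G z.2)
      (.fst ℝ Y E - (fderiv ℝ G 0).comp (.snd ℝ Y E)) z₀ :=
    hasFDerivAt_fst.sub (HasFDerivAt.comp z₀ (g := G) (f := Prod.snd)
      (hG.differentiableAt (by norm_num)).hasFDerivAt hasFDerivAt_snd)
  rw [hd.fderiv] at h0
  simp only [_root_.sub_apply, ContinuousLinearMap.coe_fst',
    ContinuousLinearMap.comp_apply, ContinuousLinearMap.coe_snd', zero_sub, norm_neg] at h0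
  have hnorm : ‖((0, v) : Y × E)‖ = ‖v‖ := by simp [Prod.norm_def]
  have h1 := (abs_le.1 (hclose (0, v))).1
  rw [hnorm, h0] at h1
  linarith [hlow v]

end Hessian

section Assembly

variable {n : ℕ}

theorem exists_contDiffAt_EvecE (n : ℕ) :
    ∃ G : EuclideanSpace ℝ (PIdx n) → EuclideanSpace ℝ (EIdx n), ContDiffAt ℝ 2 G 0 ∧
      (∀ v, 2 ^ (n + 2) * ‖v‖ ^ 2 ≤ ‖fderiv ℝ G 0 v‖ ^ 2) ∧
      ∀ᶠ x in 𝓝 0, ∀ ν : ℝ, 0 < ν → EvecE (ν • x) ν = ν • G x := by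
  choose g hg hgd hge using exists_contDiffAt_Egap (n := n)
  have hG : ContDiffAt ℝ 2 (fun x => WithLp.toLp 2 fun p => g p x :
      EuclideanSpace ℝ (PIdx n) → EuclideanSpace ℝ (EIdx n)) 0 := contDiffAt_euclidean.2 hg
  refine ⟨_, hG, fun v => ?_, ?_⟩
  · have hcoord : ∀ p, fderiv ℝ (fun x => WithLp.toLp 2 fun p => g p x :
        EuclideanSpace ℝ (PIdx n) → EuclideanSpace ℝ (EIdx n)) 0 v p = fderiv ℝ (g p) 0 v := by
      intro p
      have h := (EuclideanSpace.proj p : EuclideanSpace ℝ (EIdx n) →L[ℝ] ℝ).hasFDerivAt.comp 0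
        (hG.differentiableAt (by norm_num)).hasFDerivAt
      exact congrArg (fun L => L v) h.fderiv.symm
    simp only [EuclideanSpace.real_norm_sq_eq, hcoord, hgd]
    exact le_sum_sq_gap_derivative v
  · filter_upwards [eventually_all.2 hge] with x hx ν hν
    ext p
    exact hx p ν hν

theorem Lloss_eq_mul {G : EuclideanSpace ℝ (PIdx n) → EuclideanSpace ℝ (EIdx n)} {ν : ℝ}
    (hν : 0 < ν) {Ehat : EuclideanSpace ℝ (EIdx n)} {μ : EuclideanSpace ℝ (PIdx n)}
    (h : EvecE (ν • ν⁻¹ • μ) ν = ν • G (ν⁻¹ • μ)) :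
    Lloss Ehat μ ν = ν ^ 2 * (1 / 2 * ‖ν⁻¹ • Ehat - G (ν⁻¹ • μ)‖ ^ 2) := by
  rw [smul_inv_smul₀ hν.ne'] at h
  have h1 : Ehat - ν • G (ν⁻¹ • μ) = ν • (ν⁻¹ • Ehat - G (ν⁻¹ • μ)) := by
    rw [smul_sub, smul_inv_smul₀ hν.ne']
  rw [Lloss, h, h1, norm_smul, Real.norm_of_nonneg hν.le]
  ring

theorem norm_le_sqrt_card {ι : Type*} [Fintype ι] {x : EuclideanSpace ℝ ι}
    (h : ∀ i, |x i| ≤ 1) : ‖x‖ ≤ √(Fintype.card ι) := by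
  rw [EuclideanSpace.norm_eq]
  refine Real.sqrt_le_sqrt ((Finset.sum_le_sum fun i _ =>
    pow_le_one₀ (norm_nonneg _) (h i)).trans ?_)
  simp

/-- Rescaling by `ν` reduces the bounds on the loss at `μ` to those of a fixed least-squares
problem near the origin. -/
theorem contDiffAt_Lloss_of_least_squares
    {G : EuclideanSpace ℝ (PIdx n) → EuclideanSpace ℝ (EIdx n)} {ν K : ℝ}
    (hν : 0 < ν) {Ehat : EuclideanSpace ℝ (EIdx n)} {μ : EuclideanSpace ℝ (PIdx n)}
    (hE : ∀ᶠ x in 𝓝 (ν⁻¹ • μ), EvecE (ν • x) ν = ν • G x)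
    (hΨ : ContDiffAt ℝ 2 (fun z : EuclideanSpace ℝ (EIdx n) × EuclideanSpace ℝ (PIdx n) =>
      1 / 2 * ‖z.1 - G z.2‖ ^ 2) (ν⁻¹ • Ehat, ν⁻¹ • μ))
    (hK : ∀ v, K * ‖v‖ ^ 2 ≤ fderiv ℝ (fderiv ℝ
      fun z : EuclideanSpace ℝ (EIdx n) × EuclideanSpace ℝ (PIdx n) =>
        1 / 2 * ‖z.1 - G z.2‖ ^ 2) (ν⁻¹ • Ehat, ν⁻¹ • μ) (0, v) (0, v)) :
    ContDiffAt ℝ 2 (fun μ' => Lloss Ehat μ' ν) μ ∧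
      ∀ v, K * ‖v‖ ^ 2 ≤ fderiv ℝ (fderiv ℝ fun μ' => Lloss Ehat μ' ν) μ v v := by
  set Ψ : EuclideanSpace ℝ (EIdx n) × EuclideanSpace ℝ (PIdx n) → ℝ :=
    fun z => 1 / 2 * ‖z.1 - G z.2‖ ^ 2
  let a : EuclideanSpace ℝ (EIdx n) × EuclideanSpace ℝ (PIdx n) := (ν⁻¹ • Ehat, 0)
  let L : EuclideanSpace ℝ (PIdx n) →L[ℝ]
      EuclideanSpace ℝ (EIdx n) × EuclideanSpace ℝ (PIdx n) :=
    ContinuousLinearMap.prod 0 (ν⁻¹ • .id ℝ _)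
  have haL : ∀ x, a + L x = (ν⁻¹ • Ehat, ν⁻¹ • x) := fun x => by simp [a, L]
  have hL : ∀ x, L x = (0, ν⁻¹ • x) := fun x => by simp [L]
  have hcont : Tendsto (fun x : EuclideanSpace ℝ (PIdx n) => ν⁻¹ • x) (𝓝 μ) (𝓝 (ν⁻¹ • μ)) :=
    (continuous_const_smul ν⁻¹).continuousAt
  have heq : (fun μ' => Lloss Ehat μ' ν) =ᶠ[𝓝 μ] fun x => ν ^ 2 * Ψ (a + L x) := by
    filter_upwards [hcont.eventually hE] with x hx
    rw [haL]
    exact Lloss_eq_mul hν hx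
  rw [← haL] at hΨ hK
  have hΨ' : ContDiffAt ℝ 2 (fun z => ν ^ 2 * Ψ z) (a + L μ) := contDiffAt_const.mul hΨ
  have hcomp : ContDiffAt ℝ 2 (fun x => ν ^ 2 * Ψ (a + L x)) μ :=
    hΨ'.comp μ (f := fun x => a + L x) (contDiff_const.add L.contDiff).contDiffAt
  refine ⟨hcomp.congr_of_eventuallyEq heq, fun v => ?_⟩
  have hd : fderiv ℝ (fderiv ℝ fun z => ν ^ 2 * Ψ z) (a + L μ)
      = ν ^ 2 • fderiv ℝ (fderiv ℝ Ψ) (a + L μ) := by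
    have h1 : (fderiv ℝ fun z => ν ^ 2 * Ψ z) =ᶠ[𝓝 (a + L μ)] fun z => ν ^ 2 • fderiv ℝ Ψ z := by
      filter_upwards [hΨ.eventually (by simp)] with z hz
      exact fderiv_const_mul (hz.differentiableAt (by norm_num)) _
    rw [h1.fderiv_eq]
    exact fderiv_fun_const_smul
      ((hΨ.fderiv_right (m := 1) (by norm_num)).differentiableAt (by norm_num)) _
  rw [heq.fderiv.fderiv_eq, fderiv_fderiv_comp_affine (f := fun z => ν ^ 2 * Ψ z) a L hΨ', hd,
    hL]
  refine le_trans (le_of_eq ?_) (mul_le_mul_of_nonneg_left (hK (ν⁻¹ • v)) (sq_nonneg ν))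
  rw [norm_smul, norm_inv, Real.norm_of_nonneg hν.le]
  field_simp

end Assembly

/-- Strong convexity of the loss: for each `n ≥ 1` there are constants
`ν₀, r_λ, c > 0` (depending only on `n`) such that for `|λ_a| ≤ 1`, `ν ≥ ν₀`, `‖μ − λ‖ ≤ r_λ`
and `‖Ê − E(λ,ν)‖ ≤ cν`, the loss `μ' ↦ L(Ê, μ', ν)` is `C²` near `μ` and its Hessian at `μ`
satisfies `⟨v, Hess v⟩ ≥ 2^{n−1}‖v‖²` for all `v`. -/
theorem stmt_13 (n : ℕ) (hn : 1 ≤ n) :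
    ∃ ν₀ > (0 : ℝ), ∃ rlam > (0 : ℝ), ∃ c > (0 : ℝ),
      ∀ lam : EuclideanSpace ℝ (PIdx n), (∀ a, |lam a| ≤ 1) →
      ∀ ν : ℝ, ν₀ ≤ ν →
      ∀ μ : EuclideanSpace ℝ (PIdx n), ‖μ - lam‖ ≤ rlam →
      ∀ Ehat : EuclideanSpace ℝ (EIdx n), ‖Ehat - EvecE lam ν‖ ≤ c * ν →
        ContDiffAt ℝ 2 (fun μ' => Lloss Ehat μ' ν) μ ∧
        ∀ v : EuclideanSpace ℝ (PIdx n),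
          (2 : ℝ) ^ (n - 1) * ‖v‖ ^ 2 ≤
            fderiv ℝ (fderiv ℝ (fun μ' => Lloss Ehat μ' ν)) μ v v := by
  obtain ⟨G, hG, hlow, hGE⟩ := exists_contDiffAt_EvecE n
  have hpow : (2 : ℝ) ^ (n - 1) < 2 ^ (n + 2) := pow_lt_pow_right₀ (by norm_num) (by omega)
  obtain ⟨ε, hε, hball⟩ := Metric.eventually_nhds_iff_ball.1
    (eventually_le_hessian_least_squares hG hpow hlow)
  obtain ⟨δ, hδ, hδball⟩ := Metric.eventually_nhds_iff_ball.1
    (hGE.and (hG.continuousAt.eventually (Metric.ball_mem_nhds (G 0) (half_pos hε))))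
  set r : ℝ := min ε δ
  have hr0 : 0 < r := lt_min hε hδ
  refine ⟨(√(Fintype.card (PIdx n)) + 2) / r, by positivity, 1, one_pos, ε / 4, by positivity,
    fun lam hlam ν hν μ hμ Ehat hEhat => ?_⟩
  have hν0 : 0 < ν := lt_of_lt_of_le (by positivity) hν
  have hsmall : ∀ x : EuclideanSpace ℝ (PIdx n), ‖x - lam‖ ≤ 1 → ‖ν⁻¹ • x‖ < r := by
    intro x hx
    have h1 : ‖x‖ < √(Fintype.card (PIdx n)) + 2 := by
      have := norm_le_sqrt_card hlam
      have := norm_sub_norm_le x lam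
      linarith
    rw [norm_smul, norm_inv, Real.norm_of_nonneg hν0.le, inv_mul_lt_iff₀ hν0]
    rw [div_le_iff₀ hr0] at hν
    exact h1.trans_le hν
  have hlamδ : ν⁻¹ • lam ∈ Metric.ball (0 : EuclideanSpace ℝ (PIdx n)) δ :=
    mem_ball_zero_iff.2 ((hsmall lam (by simp)).trans_le (min_le_right _ _))
  have hμr := hsmall μ hμ
  have hEdist : dist (ν⁻¹ • Ehat) (G 0) < ε := by
    obtain ⟨h1, h2⟩ := hδball _ hlamδ
    have h3 := h1 ν hν0
    rw [smul_inv_smul₀ hν0.ne'] at h3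
    have h4 : Ehat - ν • G (ν⁻¹ • lam) = ν • (ν⁻¹ • Ehat - G (ν⁻¹ • lam)) := by
      rw [smul_sub, smul_inv_smul₀ hν0.ne']
    rw [h3, h4, norm_smul, Real.norm_of_nonneg hν0.le, mul_comm,
      mul_le_mul_iff_left₀ hν0, ← dist_eq_norm] at hEhat
    linarith [dist_triangle (ν⁻¹ • Ehat) (G (ν⁻¹ • lam)) (G 0), Metric.mem_ball.1 h2]
  obtain ⟨hΨ, hΨlow⟩ := hball (ν⁻¹ • Ehat, ν⁻¹ • μ) (by
    rw [Metric.mem_ball, Prod.dist_eq, dist_zero_right]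
    exact max_lt hEdist (hμr.trans_le (min_le_left _ _)))
  refine contDiffAt_Lloss_of_least_squares hν0 ?_ hΨ hΨlow
  filter_upwards [Metric.isOpen_ball.mem_nhds
    (mem_ball_zero_iff.2 (hμr.trans_le (min_le_right _ _)))] with x hx
  exact (hδball x hx).1 ν hν0
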